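/- Let (𝒫, ℒ) and (𝒫′, ℒ′) be linear spaces with dim(𝒫, ℒ) ≥ 3 and dim(𝒫′, ℒ′) ≥ 3, and let φ : ℒ → ℒ′ be a bijection such that a ∼ b if and only if φ(a) ∼′ φ(b) for all a, b ∈ ℒ. If φ maps some star of lines of (𝒫, ℒ) onto a coplanar maximal related set of (𝒫′, ℒ′), then (𝒫′, ℒ′) is a 3-dimensional generalized projective space. -/

import Mathlib

/-- A linear space: a point set `P` together with a set of lines (subsets of `P`),
each line having at least two points, and any two distinct points lying on
exactly one line. -/
structure LinearSpace (P : Type*) where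
  lines : Set (Set P)
  two_points : ∀ l ∈ lines, ∃ A B : P, A ≠ B ∧ A ∈ l ∧ B ∈ l
  unique_line : ∀ A B : P, A ≠ B → ∃! l, l ∈ lines ∧ A ∈ l ∧ B ∈ l

namespace LinearSpace

variable {P : Type*} (LS : LinearSpace P)

/-- A subspace: a subset containing, with any two of its distinct points,
the line joining them. -/
def IsSubspace (S : Set P) : Prop :=
  ∀ l ∈ LS.lines, ∀ A ∈ l, ∀ B ∈ l, A ≠ B → A ∈ S → B ∈ S → l ⊆ S

/-- The span of a subset: the intersection of all subspaces containing it. -/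
def span (S : Set P) : Set P :=
  ⋂₀ {T | LS.IsSubspace T ∧ S ⊆ T}

/-- The dimension of a subset `S` (intended for subspaces):
`min {#X - 1 | X ⊆ S, span X = S}` as an extended natural number. -/
noncomputable def sdim (S : Set P) : ℕ∞ :=
  sInf {d : ℕ∞ | ∃ X : Set P, X ⊆ S ∧ LS.span X = S ∧ d = X.encard - 1}

/-- The dimension of the linear space: `min {#X - 1 | span X = P}`. -/
noncomputable def dim : ℕ∞ := LS.sdim Set.univ

/-- A plane is a 2-dimensional subspace. -/
def IsPlane (E : Set P) : Prop := LS.IsSubspace E ∧ LS.sdim E = 2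

/-- A generalized projective space: every plane is a generalized projective
plane, i.e. any two distinct lines contained in a common plane meet. -/
def IsGenProjSpace : Prop :=
  ∀ E : Set P, LS.IsPlane E →
    ∀ l ∈ LS.lines, ∀ m ∈ LS.lines, l ⊆ E → m ⊆ E → l ≠ m → (l ∩ m).Nonempty

/-- A related set: a set of lines which pairwise meet. -/
def IsRelatedSet (N : Set (Set P)) : Prop :=
  N ⊆ LS.lines ∧ ∀ a ∈ N, ∀ b ∈ N, (a ∩ b).Nonempty

/-- A maximal related set: a related set maximal with respect to inclusion. -/
def IsMaxRelatedSet (M : Set (Set P)) : Prop :=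
  LS.IsRelatedSet M ∧ ∀ N, LS.IsRelatedSet N → M ⊆ N → N = M

/-- The star of lines with vertex `A`: all lines through `A`. -/
def star (A : P) : Set (Set P) := {l | l ∈ LS.lines ∧ A ∈ l}

/-- The pencil of planes with axis `a`: all planes containing `a`. -/
def pencil (a : Set P) : Set (Set P) := {E | LS.IsPlane E ∧ a ⊆ E}

/-- A collineation: a bijection of the point sets mapping each line onto a
line, and whose inverse does likewise. -/
def IsCollineation {P' : Type*} (LS' : LinearSpace P') (κ : P → P') : Prop :=
  Function.Bijective κ ∧ (∀ l ∈ LS.lines, κ '' l ∈ LS'.lines) ∧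
    (∀ l' ∈ LS'.lines, κ ⁻¹' l' ∈ LS.lines)

end LinearSpace

namespace LinearSpace

variable {P P' : Type*} {LS : LinearSpace P} {LS' : LinearSpace P'}

theorem isSubspace_span (S : Set P) : LS.IsSubspace (LS.span S) := by
  rintro l hl A hA B hB hAB hAS hBS X hX T ⟨hT, hST⟩
  exact hT l hl A hA B hB hAB (hAS T ⟨hT, hST⟩) (hBS T ⟨hT, hST⟩) hX

theorem subset_span (S : Set P) : S ⊆ LS.span S :=
  fun _ hX _ hT => hT.2 hX

theorem span_subset {S T : Set P} (hT : LS.IsSubspace T) (hST : S ⊆ T) : LS.span S ⊆ T :=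
  fun _ hX => hX T ⟨hT, hST⟩

theorem exists_line {A B : P} (h : A ≠ B) : ∃ l ∈ LS.lines, A ∈ l ∧ B ∈ l :=
  (LS.unique_line A B h).exists

theorem line_eq {l m : Set P} (hl : l ∈ LS.lines) (hm : m ∈ LS.lines) {A B : P} (h : A ≠ B)
    (hAl : A ∈ l) (hBl : B ∈ l) (hAm : A ∈ m) (hBm : B ∈ m) : l = m :=
  (LS.unique_line A B h).unique ⟨hl, hAl, hBl⟩ ⟨hm, hAm, hBm⟩

theorem line_nonempty {l : Set P} (hl : l ∈ LS.lines) : l.Nonempty :=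
  let ⟨A, _, _, hA, _⟩ := two_points _ l hl
  ⟨A, hA⟩

theorem encard_triple_le (A B C : P) : ({A, B, C} : Set P).encard ≤ 3 := by
  refine (Set.encard_insert_le _ _).trans ?_
  refine (add_le_add_left (Set.encard_insert_le _ _) 1).trans ?_
  norm_num

theorem exists_span_of_sdim_eq_two {F : Set P} (hFs : LS.IsSubspace F) (hF : LS.sdim F = 2) :
    ∃ A B C, A ≠ B ∧ A ≠ C ∧ F = LS.span {A, B, C} := by
  have hne : {d : ℕ∞ | ∃ X : Set P, X ⊆ F ∧ LS.span X = F ∧ d = X.encard - 1}.Nonempty :=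
    ⟨_, F, subset_rfl,
      subset_antisymm (fun X hX => hX F ⟨hFs, subset_rfl⟩) (subset_span F), rfl⟩
  obtain ⟨X, -, hXF, hX⟩ := csInf_mem hne
  rw [← sdim, hF] at hX
  have hX3 : X.encard = 3 := by
    have : 1 ≤ X.encard := by
      by_contra! h
      rw [tsub_eq_zero_of_le h.le] at hX
      exact absurd hX (by decide)
    rw [← tsub_add_cancel_of_le this, ← hX]
    norm_num
  obtain ⟨A, B, C, hAB, hAC, -, rfl⟩ := Set.encard_eq_three.1 hX3
  exact ⟨A, B, C, hAB, hAC, hXF.symm⟩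

theorem exists_notMem_span (hdim : 3 ≤ LS.dim) (A B C : P) : ∃ X, X ∉ LS.span {A, B, C} := by
  by_contra! h
  have h₁ : LS.dim ≤ ({A, B, C} : Set P).encard - 1 :=
    sInf_le ⟨_, Set.subset_univ _, Set.eq_univ_of_forall h, rfl⟩
  have h₃ : (3 : ℕ∞) ≤ 3 - 1 := (hdim.trans h₁).trans (tsub_le_tsub_right (encard_triple_le A B C) 1)
  exact absurd h₃ (by decide)

theorem nonempty_of_dim (hdim : 3 ≤ LS.dim) : Nonempty P := by
  by_contra h
  rw [not_nonempty_iff] at h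
  have h₁ : LS.dim ≤ (∅ : Set P).encard - 1 :=
    sInf_le ⟨∅, Set.subset_univ _, Subsingleton.elim _ _, rfl⟩
  have h₂ := hdim.trans h₁
  simp at h₂

theorem isRelatedSet_star (A : P) : LS.IsRelatedSet (LS.star A) :=
  ⟨fun _ h => h.1, fun _ ha _ hb => ⟨A, ha.2, hb.2⟩⟩

theorem isMaxRelatedSet_star (hdim : 3 ≤ LS.dim) (A : P) : LS.IsMaxRelatedSet (LS.star A) := by
  refine ⟨isRelatedSet_star A, fun N hN hAN => subset_antisymm (fun g hg => ?_) hAN⟩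
  refine ⟨hN.1 hg, ?_⟩
  by_contra hAg
  obtain ⟨B, C, hBC, hB, hC⟩ := LS.two_points g (hN.1 hg)
  obtain ⟨X, hX⟩ := exists_notMem_span hdim A B C
  have hA' : A ∈ LS.span {A, B, C} := subset_span _ (by simp)
  have hgE : g ⊆ LS.span {A, B, C} := isSubspace_span _ g (hN.1 hg) B hB C hC hBC
    (subset_span _ (by simp)) (subset_span _ (by simp))
  have hAX : A ≠ X := by rintro rfl; exact hX hA'
  obtain ⟨m, hm, hAm, hXm⟩ := LS.exists_line hAX
  obtain ⟨W, hWm, hWg⟩ := hN.2 m (hAN ⟨hm, hAm⟩) g hg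
  have hAW : A ≠ W := by rintro rfl; exact hAg hWg
  exact hX (isSubspace_span _ m hm A hAm W hWm hAW hA' (hgE hWg) hXm)

theorem IsMaxRelatedSet.exists_span [Nonempty P] {M : Set (Set P)} (hM : LS.IsMaxRelatedSet M)
    (hns : ∀ A, M ≠ LS.star A) : ∃ A B C, ∀ l ∈ M, l ⊆ LS.span {A, B, C} := by
  have hex : ∀ A, ∃ l ∈ M, A ∉ l := by
    intro A
    by_contra! h
    exact hns A (hM.2 _ (isRelatedSet_star A) fun l hl => ⟨hM.1.1 hl, h l hl⟩).symm
  obtain ⟨a, ha, -⟩ := hex (Classical.arbitrary P)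
  obtain ⟨O, hO⟩ := line_nonempty (hM.1.1 ha)
  obtain ⟨b, hb, hOb⟩ := hex O
  have hab : a ≠ b := by rintro rfl; exact hOb hO
  obtain ⟨Q, hQa, hQb⟩ := hM.1.2 a ha b hb
  obtain ⟨c, hc, hQc⟩ := hex Q
  obtain ⟨R, hRa, hRc⟩ := hM.1.2 a ha c hc
  obtain ⟨S, hSb, hSc⟩ := hM.1.2 b hb c hc
  have hmeet : ∀ X ∈ a, X ∈ b → X = Q := fun X hXa hXb => by
    by_contra h
    exact hab (line_eq (hM.1.1 ha) (hM.1.1 hb) h hXa hQa hXb hQb)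
  have hQR : Q ≠ R := by rintro rfl; exact hQc hRc
  have hQS : Q ≠ S := by rintro rfl; exact hQc hSc
  have hRS : R ≠ S := by rintro rfl; exact hQR (hmeet R hRa hSb).symm
  have hE := isSubspace_span (LS := LS) {Q, R, S}
  have hQ : Q ∈ LS.span {Q, R, S} := subset_span _ (by simp)
  have hR : R ∈ LS.span {Q, R, S} := subset_span _ (by simp)
  have hS : S ∈ LS.span {Q, R, S} := subset_span _ (by simp)
  have haE := hE a (hM.1.1 ha) Q hQa R hRa hQR hQ hR
  have hbE := hE b (hM.1.1 hb) Q hQb S hSb hQS hQ hS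
  have hcE := hE c (hM.1.1 hc) R hRc S hSc hRS hR hS
  refine ⟨Q, R, S, fun l hl => ?_⟩
  obtain ⟨U, hUl, hUa⟩ := hM.1.2 l hl a ha
  obtain ⟨V, hVl, hVb⟩ := hM.1.2 l hl b hb
  obtain ⟨W, hWl, hWc⟩ := hM.1.2 l hl c hc
  by_cases hUV : U = V
  · subst hUV
    have hUQ := hmeet U hUa hVb
    have hUW : U ≠ W := by rintro rfl; exact hQc (hUQ ▸ hWc)
    exact hE l (hM.1.1 hl) U hUl W hWl hUW (haE hUa) (hcE hWc)
  · exact hE l (hM.1.1 hl) U hUl V hVl hUV (haE hUa) (hbE hVb)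

/-- A bijection between the line sets of two linear spaces that preserves relatedness in both
directions. -/
structure IsLineIso (LS : LinearSpace P) (LS' : LinearSpace P') (φ : Set P → Set P') : Prop where
  bijOn : Set.BijOn φ LS.lines LS'.lines
  inter_nonempty_iff : ∀ a ∈ LS.lines, ∀ b ∈ LS.lines,
    ((a ∩ b).Nonempty ↔ (φ a ∩ φ b).Nonempty)

namespace IsLineIso

variable {φ : Set P → Set P'}

theorem isMaxRelatedSet_image_star (hφ : IsLineIso LS LS' φ) (hdim : 3 ≤ LS.dim) (A : P) :
    LS'.IsMaxRelatedSet (φ '' LS.star A) := by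
  refine ⟨⟨?_, ?_⟩, fun N hN hAN => subset_antisymm ?_ hAN⟩
  · rintro _ ⟨a, ha, rfl⟩
    exact hφ.bijOn.mapsTo ha.1
  · rintro _ ⟨a, ha, rfl⟩ _ ⟨b, hb, rfl⟩
    exact (hφ.inter_nonempty_iff a ha.1 b hb.1).1 ⟨A, ha.2, hb.2⟩
  · have hpre : {l | l ∈ LS.lines ∧ φ l ∈ N} = LS.star A := by
      refine (isMaxRelatedSet_star hdim A).2 _ ⟨fun l hl => hl.1, fun a ha b hb => ?_⟩
        fun l hl => ⟨hl.1, hAN ⟨l, hl, rfl⟩⟩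
      exact (hφ.inter_nonempty_iff a ha.1 b hb.1).2 (hN.2 _ ha.2 _ hb.2)
    intro n hn
    obtain ⟨l, hl, rfl⟩ := hφ.bijOn.surjOn (hN.1 hn)
    exact ⟨l, hpre ▸ ⟨hl, hn⟩, rfl⟩

/-- If `φ` maps the lines through `A` into a subspace `E` and `φ x` meets `E` in the single point
`Q`, then `φ` maps the lines joining `A` with the points of `x` to lines through `Q`. -/
theorem exists_line_of_mem (hφ : IsLineIso LS LS' φ) {A : P} {E : Set P'} (hE : LS'.IsSubspace E)
    (hAE : ∀ a ∈ LS.star A, φ a ⊆ E) {x : Set P} (hx : x ∈ LS.lines) {X Q : P'} (hXE : X ∉ E)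
    (hXx : X ∈ φ x) (hQE : Q ∈ E) (hQx : Q ∈ φ x) {Y : P} (hY : Y ∈ x) :
    A ≠ Y ∧ ∃ a ∈ LS.lines, A ∈ a ∧ Y ∈ a ∧ Q ∈ φ a := by
  have hAY : A ≠ Y := by
    rintro rfl
    exact hXE (hAE x ⟨hx, hY⟩ hXx)
  refine ⟨hAY, ?_⟩
  obtain ⟨a, ha, hAa, hYa⟩ := LS.exists_line hAY
  refine ⟨a, ha, hAa, hYa, ?_⟩
  obtain ⟨W, hWa, hWx⟩ := (hφ.inter_nonempty_iff a ha x hx).1 ⟨Y, hYa, hY⟩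
  by_cases hWQ : W = Q
  · exact hWQ ▸ hWa
  · exact absurd (hE _ (hφ.bijOn.mapsTo hx) W hWx Q hQx hWQ (hAE a ⟨ha, hAa⟩ hWa) hQE hXx) hXE

/-- A subspace containing the images of all lines through `A` and missing some point contains no
other lines. -/
theorem image_star_eq (hφ : IsLineIso LS LS' φ) {A : P} {E : Set P'} (hE : LS'.IsSubspace E)
    (hAE : ∀ a ∈ LS.star A, φ a ⊆ E) {X : P'} (hXE : X ∉ E) :
    φ '' LS.star A = {l | l ∈ LS'.lines ∧ l ⊆ E} := by
  refine subset_antisymm ?_ ?_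
  · rintro _ ⟨a, ha, rfl⟩
    exact ⟨hφ.bijOn.mapsTo ha.1, hAE a ha⟩
  · rintro d ⟨hd, hdE⟩
    obtain ⟨Q, R, hQR, hQ, hR⟩ := LS'.two_points d hd
    have hXQ : X ≠ Q := by rintro rfl; exact hXE (hdE hQ)
    have hXR : X ≠ R := by rintro rfl; exact hXE (hdE hR)
    obtain ⟨_, hx', hXx, hQx⟩ := LS'.exists_line hXQ
    obtain ⟨_, hy', hXy, hRy⟩ := LS'.exists_line hXR
    obtain ⟨x, hx, rfl⟩ := hφ.bijOn.surjOn hx'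
    obtain ⟨y, hy, rfl⟩ := hφ.bijOn.surjOn hy'
    obtain ⟨W, hWx, hWy⟩ := (hφ.inter_nonempty_iff x hx y hy).2 ⟨X, hXx, hXy⟩
    obtain ⟨hAW, a, ha, hAa, hWa, hQa⟩ :=
      hφ.exists_line_of_mem hE hAE hx hXE hXx (hdE hQ) hQx hWx
    obtain ⟨-, b, hb, hAb, hWb, hRb⟩ :=
      hφ.exists_line_of_mem hE hAE hy hXE hXy (hdE hR) hRy hWy
    obtain rfl := line_eq ha hb hAW hAa hWa hAb hWb
    exact ⟨a, ⟨ha, hAa⟩, line_eq (hφ.bijOn.mapsTo ha) hd hQR hQa hRb hQ hR⟩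

theorem exists_image_star_eq (hφ : IsLineIso LS LS' φ) (hdim : 3 ≤ LS.dim) (hdim' : 3 ≤ LS'.dim)
    {A : P} (hns : ∀ A', φ '' LS.star A ≠ LS'.star A') :
    ∃ Q R S, φ '' LS.star A = {l | l ∈ LS'.lines ∧ l ⊆ LS'.span {Q, R, S}} := by
  have := nonempty_of_dim hdim'
  obtain ⟨Q, R, S, h⟩ := (hφ.isMaxRelatedSet_image_star hdim A).exists_span hns
  obtain ⟨X, hX⟩ := exists_notMem_span hdim' Q R S
  exact ⟨Q, R, S, hφ.image_star_eq (isSubspace_span _) (fun a ha => h _ ⟨a, ha, rfl⟩) hX⟩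

theorem image_star_ne_star (hφ : IsLineIso LS LS' φ) (hdim : 3 ≤ LS.dim) (hdim' : 3 ≤ LS'.dim)
    {A : P} (hns : ∀ A', φ '' LS.star A ≠ LS'.star A') (B : P) (Q : P') :
    φ '' LS.star B ≠ LS'.star Q := by
  by_cases hAB : A = B
  · exact hAB ▸ hns Q
  intro hBQ
  obtain ⟨R, S, T, h⟩ := hφ.exists_image_star_eq hdim hdim' hns
  obtain ⟨X, hXE⟩ := exists_notMem_span hdim' R S T
  have hAE : ∀ a ∈ LS.star A, φ a ⊆ LS'.span {R, S, T} := fun a ha =>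
    (h.subset ⟨a, ha, rfl⟩).2
  have hBmem : ∀ l ∈ LS.lines, Q ∈ φ l → B ∈ l := fun l hl hQ => by
    obtain ⟨m, hm, hml⟩ := hBQ.superset ⟨hφ.bijOn.mapsTo hl, hQ⟩
    exact hφ.bijOn.injOn hm.1 hl hml ▸ hm.2
  obtain ⟨c, hc, hAc, hBc⟩ := LS.exists_line hAB
  have hQE : Q ∈ LS'.span {R, S, T} := hAE c ⟨hc, hAc⟩ (hBQ.subset ⟨c, ⟨hc, hBc⟩, rfl⟩).2
  have hXQ : X ≠ Q := by rintro rfl; exact hXE hQE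
  obtain ⟨_, hx', hXx, hQx⟩ := LS'.exists_line hXQ
  obtain ⟨x, hx, rfl⟩ := hφ.bijOn.surjOn hx'
  have hmem : ∀ Y ∈ x, Y ∈ c := fun Y hY => by
    obtain ⟨-, a, ha, hAa, hYa, hQa⟩ :=
      hφ.exists_line_of_mem (isSubspace_span _) hAE hx hXE hXx hQE hQx hY
    rwa [line_eq hc ha hAB hAc hBc hAa (hBmem a ha hQa)]
  obtain ⟨Y, Z, hYZ, hY, hZ⟩ := LS.two_points x hx
  obtain rfl := line_eq hc hx hYZ (hmem Y hY) (hmem Z hZ) hY hZ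
  exact hXE (hAE c ⟨hc, hAc⟩ hXx)

theorem dim_eq_three (hφ : IsLineIso LS LS' φ) (hdim : 3 ≤ LS.dim) (hdim' : 3 ≤ LS'.dim)
    {A : P} (hns : ∀ A', φ '' LS.star A ≠ LS'.star A') : LS'.dim = 3 := by
  refine le_antisymm ?_ hdim'
  obtain ⟨Q, R, S, h⟩ := hφ.exists_image_star_eq hdim hdim' hns
  obtain ⟨X, hXE⟩ := exists_notMem_span hdim' Q R S
  have hmeet : ∀ l ∈ LS'.lines, (l ∩ LS'.span {Q, R, S}).Nonempty := by
    intro l hl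
    obtain ⟨y, hy, rfl⟩ := hφ.bijOn.surjOn hl
    obtain ⟨Y, hY⟩ := line_nonempty hy
    have : ∃ a ∈ LS.star A, Y ∈ a := by
      by_cases hAY : A = Y
      · exact ⟨y, ⟨hy, hAY ▸ hY⟩, hY⟩
      · obtain ⟨a, ha, hAa, hYa⟩ := LS.exists_line hAY
        exact ⟨a, ⟨ha, hAa⟩, hYa⟩
    obtain ⟨a, ha, hYa⟩ := this
    obtain ⟨W, hWy, hWa⟩ := (hφ.inter_nonempty_iff y hy a ha.1).1 ⟨Y, hY, hYa⟩
    exact ⟨W, hWy, (h.subset ⟨a, ha, rfl⟩).2 hWa⟩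
  have hspan : LS'.span {X, Q, R, S} = Set.univ := by
    refine Set.eq_univ_of_forall fun Y => ?_
    have hX : X ∈ LS'.span {X, Q, R, S} := subset_span _ (by simp)
    by_cases hXY : X = Y
    · exact hXY ▸ hX
    obtain ⟨l, hl, hXl, hYl⟩ := LS'.exists_line hXY
    obtain ⟨Z, hZl, hZ⟩ := hmeet l hl
    have hXZ : X ≠ Z := by rintro rfl; exact hXE hZ
    have hsub : LS'.span {Q, R, S} ⊆ LS'.span {X, Q, R, S} :=
      span_subset (isSubspace_span _) ((Set.subset_insert _ _).trans (subset_span _))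
    exact isSubspace_span _ l hl X hXl Z hZl hXZ hX (hsub hZ) hYl
  have h₁ : LS'.dim ≤ ({X, Q, R, S} : Set P').encard - 1 :=
    sInf_le ⟨_, Set.subset_univ _, hspan, rfl⟩
  have h₂ : ({X, Q, R, S} : Set P').encard ≤ 3 + 1 :=
    (Set.encard_insert_le _ _).trans (add_le_add_left (encard_triple_le Q R S) 1)
  exact h₁.trans (tsub_le_iff_right.2 h₂)

theorem isGenProjSpace (hφ : IsLineIso LS LS' φ) (hdim : 3 ≤ LS.dim) (hdim' : 3 ≤ LS'.dim)
    {A : P} (hns : ∀ A', φ '' LS.star A ≠ LS'.star A') : LS'.IsGenProjSpace := by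
  rintro F ⟨hFs, hF⟩ l hl m hm hlF hmF -
  obtain ⟨X, Y, Z, hXY, hXZ, rfl⟩ := exists_span_of_sdim_eq_two hFs hF
  obtain ⟨_, hb', hXb, hYb⟩ := LS'.exists_line hXY
  obtain ⟨_, hc', hXc, hZc⟩ := LS'.exists_line hXZ
  obtain ⟨b, hb, rfl⟩ := hφ.bijOn.surjOn hb'
  obtain ⟨c, hc, rfl⟩ := hφ.bijOn.surjOn hc'
  obtain ⟨B, hBb, hBc⟩ := (hφ.inter_nonempty_iff b hb c hc).2 ⟨X, hXb, hXc⟩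
  obtain ⟨Q, R, S, h⟩ := hφ.exists_image_star_eq hdim hdim'
    (hφ.image_star_ne_star hdim hdim' hns B)
  have hbE := (h.subset ⟨b, ⟨hb, hBb⟩, rfl⟩).2
  have hcE := (h.subset ⟨c, ⟨hc, hBc⟩, rfl⟩).2
  have hsub : LS'.span {X, Y, Z} ⊆ LS'.span {Q, R, S} := by
    refine span_subset (isSubspace_span _) ?_
    rintro W (rfl | rfl | rfl)
    exacts [hbE hXb, hbE hYb, hcE hZc]
  exact (hφ.isMaxRelatedSet_image_star hdim B).1.2 l (h.superset ⟨hl, hlF.trans hsub⟩)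
    m (h.superset ⟨hm, hmF.trans hsub⟩)

end IsLineIso

end LinearSpace

/-- If a relatedness-preserving line bijection `φ` (both directions, dimensions
at least 3) maps some star of lines onto a coplanar maximal related set (a
maximal related set which is not a star), then `(P', L')` is a 3-dimensional
generalized projective space. -/
theorem target_genProjSpace_of_star_to_coplanar
    {P P' : Type*} (LS : LinearSpace P) (LS' : LinearSpace P')
    (hdim : 3 ≤ LS.dim) (hdim' : 3 ≤ LS'.dim)
    (φ : Set P → Set P') (hbij : Set.BijOn φ LS.lines LS'.lines)
    (hrel : ∀ a ∈ LS.lines, ∀ b ∈ LS.lines,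
      ((a ∩ b).Nonempty ↔ (φ a ∩ φ b).Nonempty))
    (hstar : ∃ A : P, LS'.IsMaxRelatedSet (φ '' LS.star A) ∧
      ∀ A' : P', φ '' LS.star A ≠ LS'.star A') :
    LS'.dim = 3 ∧ LS'.IsGenProjSpace := by
  obtain ⟨A, -, hns⟩ := hstar
  have hφ : LinearSpace.IsLineIso LS LS' φ := ⟨hbij, hrel⟩
  exact ⟨hφ.dim_eq_three hdim hdim' hns, hφ.isGenProjSpace hdim hdim' hns⟩
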